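/- For any 2 ≤ k ≤ n with n = dk + r, 0 ≤ r < k, the width-k type-D Eulerian polynomial satisfies Σ_{π ∈ D_n} x^{des_k^D(π)} = 2^{n-d-1} · M_{n,k} · B_d(x) · A_d(x)^{k-r-1} · A_{d+1}(x)^r; in particular it equals half the width-k type-B Eulerian polynomial. -/

import Mathlib

open Finset

/-- The value function of the signed permutation determined by `σ` and sign vector `ε`:
`bval n σ ε i` is `π(i)` for `i ∈ {-n,…,n}`, with `π(0) = 0` and `π(-i) = -π(i)`. -/
def bval (n : ℕ) (σ : Equiv.Perm (Fin n)) (ε : Fin n → Bool) : ℤ → ℤ := fun i =>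
  if h : 1 ≤ i.natAbs ∧ i.natAbs ≤ n then
    (Int.sign i) *
      (if ε ⟨i.natAbs - 1, by omega⟩ then -((((σ ⟨i.natAbs - 1, by omega⟩ : Fin n) : ℕ) : ℤ) + 1)
       else (((σ ⟨i.natAbs - 1, by omega⟩ : Fin n) : ℕ) : ℤ) + 1)
  else 0

/-- width-`k` type-B descent number: `#{0 ≤ i ≤ n-k : π(i) > π(i+k)}`, `π(0)=0`. -/
def desB (n k : ℕ) (π : ℤ → ℤ) : ℕ :=
  ((range (n - k + 1)).filter fun i : ℕ => π i > π ((i : ℤ) + k)).card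

/-- width-`k` type-A descent number: `#{1 ≤ i ≤ n-k : π(i) > π(i+k)}`. -/
def desA (n k : ℕ) (π : ℤ → ℤ) : ℕ :=
  ((Icc 1 (n - k)).filter fun i : ℕ => π i > π ((i : ℤ) + k)).card

/-- width-`k` negative descent number: `#{1 ≤ i ≤ n-k : π(-i) > π(i+k)}`. -/
def ndesB (n k : ℕ) (π : ℤ → ℤ) : ℕ :=
  ((Icc 1 (n - k)).filter fun i : ℕ => π (-(i : ℤ)) > π ((i : ℤ) + k)).card

/-- width-`k` inversion number: pairs `i < j` in `[n]` with `j - i` a positive multiple of `k`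
and `π(i) > π(j)`. -/
def invAk (n k : ℕ) (π : ℤ → ℤ) : ℕ :=
  (((Icc 1 n) ×ˢ (Icc 1 n)).filter fun p : ℕ × ℕ =>
    p.1 < p.2 ∧ k ∣ (p.2 - p.1) ∧ π p.1 > π p.2).card

/-- width-`k` negative-entry statistic: `#{1 ≤ i ≤ ⌊n/k⌋ : π(ik) < 0}`. -/
def negk (n k : ℕ) (π : ℤ → ℤ) : ℕ :=
  ((Icc 1 (n / k)).filter fun i : ℕ => π ((i : ℤ) * k) < 0).card

/-- width-`k` negative-sum-pair statistic. -/
def nspk (n k : ℕ) (π : ℤ → ℤ) : ℕ :=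
  (((Icc 1 n) ×ˢ (Icc 1 n)).filter fun p : ℕ × ℕ =>
    p.1 < p.2 ∧ k ∣ (p.2 - p.1) ∧ π p.1 + π p.2 < 0).card

/-- width-`k` type-B inversion number. -/
def invBk (n k : ℕ) (π : ℤ → ℤ) : ℕ := invAk n k π + negk n k π + nspk n k π

/-- The classical Eulerian polynomial `A_m(x) = Σ_{σ ∈ S_m} x^{des^A(σ)}`, evaluated at `x`. -/
def EulA {R : Type*} [CommRing R] (m : ℕ) (x : R) : R :=
  ∑ σ : Equiv.Perm (Fin m), x ^ desA m 1 (bval m σ fun _ => false)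

/-- The type-B Eulerian polynomial `B_m(x) = Σ_{π ∈ B_m} x^{des^B(π)}`, evaluated at `x`. -/
def EulB {R : Type*} [CommRing R] (m : ℕ) (x : R) : R :=
  ∑ σ : Equiv.Perm (Fin m), ∑ ε : Fin m → Bool, x ^ desB m 1 (bval m σ ε)

/-- The multinomial coefficient `M_{n,k} = n! / ((d+1)!^r d!^{k-r})` where `n = dk + r`. -/
def Mnk (n k : ℕ) : ℕ :=
  n.factorial / ((n / k + 1).factorial ^ (n % k) * (n / k).factorial ^ (k - n % k))

/-! ### Helpers -/

/-- the sign attached to a Boolean -/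
def sgB (b : Bool) : ℤ := if b then -1 else 1

/-- extension of a finite word by zero -/
def extW (m : ℕ) (v : Fin m → ℤ) (q : ℕ) : ℤ := if h : q < m then v ⟨q, h⟩ else 0

/-- type-A descents of a finite word -/
def dA (m : ℕ) (v : Fin m → ℤ) : ℕ :=
  ((range (m - 1)).filter fun q => extW m v q > extW m v (q + 1)).card

/-- type-B descents of a finite word -/
def dB (m : ℕ) (v : Fin m → ℤ) : ℕ := dA m v + if 0 > extW m v 0 then 1 else 0

/-- weight of a sign vector -/
def tw {R : Type*} [CommRing R] (t : R) {ι : Type*} [Fintype ι] (δ : ι → Bool) : R :=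
  ∏ q, if δ q then t else 1

/-- the word of a signed permutation -/
def wd (n : ℕ) (σ : Equiv.Perm (Fin n)) (ε : Fin n → Bool) (p : Fin n) : ℤ :=
  sgB (ε p) * (((σ p : ℕ) : ℤ) + 1)

lemma bval_succ (n : ℕ) (σ : Equiv.Perm (Fin n)) (ε : Fin n → Bool) (i : ℕ) :
    bval n σ ε ((i : ℤ) + 1) = extW n (wd n σ ε) i := by
  have h1 : ((i : ℤ) + 1).natAbs = i + 1 := by omega
  have h2 : Int.sign ((i : ℤ) + 1) = 1 := Int.sign_eq_one_of_pos (by omega)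
  unfold bval extW wd sgB
  by_cases h : i < n
  · have h3 : 1 ≤ ((i : ℤ) + 1).natAbs ∧ ((i : ℤ) + 1).natAbs ≤ n := by omega
    rw [dif_pos h3, dif_pos h, h2]
    simp only [h1, Nat.add_sub_cancel]
    split_ifs <;> ring
  · have h3 : ¬ (1 ≤ ((i : ℤ) + 1).natAbs ∧ ((i : ℤ) + 1).natAbs ≤ n) := by omega
    rw [dif_neg h3, dif_neg h]

lemma bval_zero (n : ℕ) (σ : Equiv.Perm (Fin n)) (ε : Fin n → Bool) :
    bval n σ ε 0 = 0 := by
  simp [bval]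

lemma desA_one (m : ℕ) (σ : Equiv.Perm (Fin m)) (ε : Fin m → Bool) :
    desA m 1 (bval m σ ε) = dA m (wd m σ ε) := by
  unfold desA dA
  symm
  apply Finset.card_bij (fun q _ => q + 1)
  · intro q hq
    simp only [mem_filter, mem_range, mem_Icc] at hq ⊢
    refine ⟨by omega, ?_⟩
    have := hq.2
    rw [← bval_succ, ← bval_succ] at this
    push_cast at this ⊢
    exact this
  · intro a _ b _ h
    omega
  · intro b hb
    simp only [mem_filter, mem_Icc] at hb
    obtain ⟨q, rfl⟩ : ∃ q, b = q + 1 := ⟨b - 1, by omega⟩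
    refine ⟨q, ?_, rfl⟩
    simp only [mem_filter, mem_range]
    refine ⟨by omega, ?_⟩
    rw [← bval_succ, ← bval_succ]
    have := hb.2
    push_cast at this ⊢
    exact this

lemma desB_split (n k : ℕ) (hk : 1 ≤ k) (σ : Equiv.Perm (Fin n)) (ε : Fin n → Bool) :
    desB n k (bval n σ ε) =
      ((range (n - k)).filter fun i =>
        extW n (wd n σ ε) i > extW n (wd n σ ε) (i + k)).card
      + if 0 > extW n (wd n σ ε) (k - 1) then 1 else 0 := by
  unfold desB
  rw [Finset.range_add_one', Finset.filter_insert]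
  have h0 : (bval n σ ε ((0 : ℕ) : ℤ) > bval n σ ε (((0 : ℕ) : ℤ) + k)) ↔
      0 > extW n (wd n σ ε) (k - 1) := by
    rw [← bval_succ]
    have : (((k - 1 : ℕ) : ℤ) + 1) = ((0 : ℕ) : ℤ) + k := by omega
    rw [this]
    simp [bval_zero]
  have h1 : (Finset.filter (fun i : ℕ => bval n σ ε i > bval n σ ε ((i : ℤ) + k))
      (Finset.map ⟨fun i => i + 1, fun i j => by simp⟩ (range (n - k)))).card =
      ((range (n - k)).filter fun i =>
        extW n (wd n σ ε) i > extW n (wd n σ ε) (i + k)).card := by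
    rw [Finset.filter_map, Finset.card_map]
    congr 1
    apply Finset.filter_congr
    intro i _
    simp only [Function.comp]
    rw [← bval_succ, ← bval_succ]
    have : (((i + k : ℕ) : ℤ) + 1) = ((i + 1 : ℕ) : ℤ) + k := by push_cast; ring
    rw [this]
    push_cast
    rfl
  simp only [h0]
  split_ifs with h
  · rw [Finset.card_insert_of_notMem, h1]
    simp
  · rw [h1]; rfl

lemma desB_one (m : ℕ) (σ : Equiv.Perm (Fin m)) (ε : Fin m → Bool) :
    desB m 1 (bval m σ ε) = dB m (wd m σ ε) := by
  rw [desB_split m 1 le_rfl]; rfl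

lemma exists_std {m : ℕ} (u : Fin m → ℤ) (hu : Function.Injective u) :
    ∃ τ : Equiv.Perm (Fin m), ∀ p q, u p < u q ↔ τ p < τ q := by
  refine ⟨(Tuple.sort u)⁻¹, fun p q => ?_⟩
  have hm : StrictMono (u ∘ Tuple.sort u) :=
    (Tuple.monotone_sort u).strictMono_of_injective (hu.comp (Tuple.sort u).injective)
  have := hm.lt_iff_lt (a := (Tuple.sort u)⁻¹ p) (b := (Tuple.sort u)⁻¹ q)
  simpa using this

lemma dA_congr {m : ℕ} (v w : Fin m → ℤ) (h : ∀ p q, v p > v q ↔ w p > w q) :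
    dA m v = dA m w := by
  unfold dA
  congr 1
  apply Finset.filter_congr
  intro q hq
  rw [mem_range] at hq
  unfold extW
  rw [dif_pos (by omega), dif_pos (by omega), dif_pos (by omega), dif_pos (by omega)]
  exact h _ _

lemma dB_congr {m : ℕ} (v w : Fin m → ℤ) (h : ∀ p q, v p > v q ↔ w p > w q)
    (h0 : ∀ p, 0 > v p ↔ 0 > w p) :
    dB m v = dB m w := by
  unfold dB
  rw [dA_congr v w h]
  congr 1
  unfold extW
  split_ifs <;> simp_all

section
variable {R : Type*} [CommRing R] (t x : R)

lemma sum_tw (m : ℕ) : ∑ δ : Fin m → Bool, tw t δ = (1 + t) ^ m := by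
  unfold tw
  have := Finset.prod_univ_sum (fun _ : Fin m => (univ : Finset Bool))
    (fun _ b => if b then t else (1 : R))
  rw [Fintype.piFinset_univ] at this
  rw [← this]
  simp [add_comm]

lemma tw_comp {ι κ : Type*} [Fintype ι] [Fintype κ] (e : ι ≃ κ) (δ : κ → Bool) :
    tw t (fun q => δ (e q)) = tw t δ := by
  unfold tw
  exact e.prod_comp (fun q => if δ q then t else 1)

/-- the signed type B Eulerian polynomial -/
def EulBt (m : ℕ) : R :=
  ∑ σ : Equiv.Perm (Fin m), ∑ ε : Fin m → Bool, tw t ε * x ^ dB m (wd m σ ε)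

lemma sgB_mul_inj {m : ℕ} (a : Fin m → ℤ) (ha : Function.Injective a) (hp : ∀ q, 0 < a q)
    (δ : Fin m → Bool) : Function.Injective fun q => sgB (δ q) * a q := by
  intro p q h
  have h1 := hp p
  have h2 := hp q
  apply ha
  simp only [sgB] at h
  split_ifs at h <;> omega

lemma lemA {m : ℕ} (a : Fin m → ℤ) (ha : Function.Injective a) (hp : ∀ q, 0 < a q) :
    ∑ δ : Fin m → Bool, ∑ h : Equiv.Perm (Fin m),
      tw t δ * x ^ dA m (fun q => sgB (δ (h q)) * a (h q)) = (1 + t) ^ m * EulA m x := by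
  rw [← sum_tw, Finset.sum_mul]
  apply Finset.sum_congr rfl
  intro δ _
  rw [← Finset.mul_sum]
  congr 1
  obtain ⟨τ, hτ⟩ := exists_std _ (sgB_mul_inj a ha hp δ)
  unfold EulA
  refine Fintype.sum_equiv (Equiv.mulLeft τ) _ _ (fun h => ?_)
  rw [desA_one]
  congr 1
  apply dA_congr
  intro p q
  have := hτ (h q) (h p)
  simp only [gt_iff_lt]
  rw [this]
  simp [wd, sgB]

lemma lemB {m : ℕ} (a : Fin m → ℤ) (ha : Function.Injective a) (hp : ∀ q, 0 < a q) :
    ∑ δ : Fin m → Bool, ∑ h : Equiv.Perm (Fin m),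
      tw t δ * x ^ dB m (fun q => sgB (δ (h q)) * a (h q)) = EulBt t x m := by
  obtain ⟨τ, hτ⟩ := exists_std a ha
  rw [Finset.sum_comm]
  unfold EulBt
  refine Fintype.sum_equiv (Equiv.mulLeft τ) _ _ (fun h => ?_)
  refine Fintype.sum_equiv (Equiv.arrowCongr h.symm (Equiv.refl Bool)) _ _ (fun ε => ?_)
  have e1 : tw t ((Equiv.arrowCongr h.symm (Equiv.refl Bool)) ε) = tw t ε :=
    tw_comp t h ε
  rw [e1]
  congr 2
  apply dB_congr
  · intro p q
    have h1 := hτ (h q) (h p)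
    have h2 := hτ (h p) (h q)
    have h3 := hp (h p)
    have h4 := hp (h q)
    rw [Fin.lt_def] at h1 h2
    simp only [wd, sgB, Equiv.arrowCongr_apply, Equiv.coe_refl, Function.comp, id,
      Equiv.symm_symm, Equiv.coe_mulLeft, Equiv.Perm.mul_apply]
    split_ifs <;> omega
  · intro p
    have h3 := hp (h p)
    simp only [wd, sgB, Equiv.arrowCongr_apply, Equiv.coe_refl, Function.comp, id,
      Equiv.symm_symm, Equiv.coe_mulLeft, Equiv.Perm.mul_apply]
    split_ifs <;> omega

end

/-- size of the residue class `j` -/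
def cls (n k j : ℕ) : ℕ := n / k + if j < n % k then 1 else 0

lemma cls_iff (n k j q : ℕ) (hj : j < k) : q < cls n k j ↔ q * k + j < n := by
  have h := Nat.div_add_mod n k
  have hr := Nat.mod_lt n (show k > 0 by omega)
  set d := n / k
  set r := n % k
  unfold cls
  constructor
  · intro hq
    by_cases hjr : j < r
    · rw [if_pos hjr] at hq
      have : q * k ≤ d * k := Nat.mul_le_mul_right k (by omega)
      nlinarith
    · rw [if_neg hjr] at hq
      have : (q + 1) * k ≤ d * k := Nat.mul_le_mul_right k (by omega)
      nlinarith
  · intro hq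
    by_contra hc
    by_cases hjr : j < r
    · rw [if_pos hjr] at hc
      have : (d + 1) * k ≤ q * k := Nat.mul_le_mul_right k (by omega)
      nlinarith
    · rw [if_neg hjr] at hc
      have : d * k ≤ q * k := Nat.mul_le_mul_right k (by omega)
      nlinarith

/-- positions sorted by residue class -/
def posE (n k : ℕ) (hk : 0 < k) : (Σ j : Fin k, Fin (cls n k j)) ≃ Fin n where
  toFun p := ⟨p.2 * k + p.1, (cls_iff n k p.1 p.2 p.1.2).1 p.2.2⟩
  invFun i := ⟨⟨i % k, Nat.mod_lt _ hk⟩, ⟨i / k, (cls_iff n k _ _ (Nat.mod_lt _ hk)).2 (by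
    rw [Nat.div_add_mod']; exact i.2)⟩⟩
  left_inv := by
    rintro ⟨⟨j, hj⟩, ⟨q, hq⟩⟩
    have h1 : (q * k + j) % k = j := by
      rw [Nat.mul_add_mod', Nat.mod_eq_of_lt hj]
    have h2 : (q * k + j) / k = q := by
      rw [Nat.add_div_of_dvd_right (Dvd.intro_left q rfl), Nat.mul_div_cancel _ hk,
        Nat.div_eq_of_lt hj, add_zero]
    exact Sigma.ext (Fin.ext h1) ((Fin.heq_ext_iff (by simp only [h1])).2 h2)
  right_inv := by
    intro i
    ext
    simp [Nat.div_add_mod']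

lemma extW_class (n k : ℕ) (hk : 0 < k) (v : Fin n → ℤ) (j : Fin k) (q : ℕ) :
    extW (cls n k j) (fun q => v (posE n k hk ⟨j, q⟩)) q = extW n v (q * k + j) := by
  unfold extW
  by_cases h : q < cls n k j
  · rw [dif_pos h, dif_pos ((cls_iff n k j q j.2).1 h)]
    rfl
  · rw [dif_neg h, dif_neg (fun h' => h ((cls_iff n k j q j.2).2 h'))]

lemma count_split (n k : ℕ) (hk : 0 < k) (v : Fin n → ℤ) :
    ((range (n - k)).filter fun i => extW n v i > extW n v (i + k)).card =
      ∑ j : Fin k, dA (cls n k j) (fun q => v (posE n k hk ⟨j, q⟩)) := by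
  rw [Finset.card_eq_sum_card_fiberwise (f := fun i => (⟨i % k, Nat.mod_lt _ hk⟩ : Fin k))
    (t := univ) (fun _ _ => by simp)]
  apply Finset.sum_congr rfl
  intro j _
  unfold dA
  symm
  apply Finset.card_bij (fun q _ => q * k + j)
  · intro q hq
    simp only [mem_filter, mem_range, extW_class] at hq ⊢
    have h1 := (cls_iff n k j (q + 1) j.2).1 (by omega)
    have h2 : (q + 1) * k + j = q * k + j + k := by ring
    rw [h2] at hq h1
    refine ⟨⟨by omega, hq.2⟩, ?_⟩
    ext
    simp [Nat.mod_eq_of_lt j.2]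
  · intro a _ b _ h
    have : a * k = b * k := by omega
    exact Nat.eq_of_mul_eq_mul_right hk this
  · intro i hi
    simp only [mem_filter, mem_range] at hi
    obtain ⟨⟨hi1, hi2⟩, hi3⟩ := hi
    have hj : i % k = j := congrArg Fin.val hi3
    have hdm : i / k * k + j = i := by rw [← hj]; exact Nat.div_add_mod' i k
    refine ⟨i / k, ?_, hdm⟩
    simp only [mem_filter, mem_range, extW_class]
    have h2 : (i / k + 1) * k + j = i + k := by rw [add_mul]; omega
    have h1 := (cls_iff n k j (i / k + 1) j.2).2 (by omega)
    refine ⟨by omega, ?_⟩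
    rw [h2, hdm]
    exact hi2

/-- descents contributed by the residue class `j` -/
def dj (k j m : ℕ) (v : Fin m → ℤ) : ℕ := if j + 1 = k then dB m v else dA m v

lemma desB_class (n k : ℕ) (hk : 0 < k) (σ : Equiv.Perm (Fin n)) (ε : Fin n → Bool) :
    desB n k (bval n σ ε) =
      ∑ j : Fin k, dj k j (cls n k j) (fun q => wd n σ ε (posE n k hk ⟨j, q⟩)) := by
  rw [desB_split n k hk, count_split n k hk]
  have h1 : ∀ j : Fin k, dj k j (cls n k j) (fun q => wd n σ ε (posE n k hk ⟨j, q⟩)) =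
      dA (cls n k j) (fun q => wd n σ ε (posE n k hk ⟨j, q⟩)) +
      if j = (⟨k - 1, by omega⟩ : Fin k) then
        (if 0 > extW n (wd n σ ε) (k - 1) then 1 else 0) else 0 := by
    intro j
    unfold dj
    by_cases h : (j : ℕ) + 1 = k
    · have h2 : j = (⟨k - 1, by omega⟩ : Fin k) := Fin.ext (by simp; omega)
      rw [if_pos h, if_pos h2]
      unfold dB
      rw [extW_class]
      have h3 : 0 * k + (j : ℕ) = k - 1 := by omega
      rw [h3]
    · have h2 : ¬ j = (⟨k - 1, by omega⟩ : Fin k) := fun h' => h (by rw [h']; simp; omega)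
      rw [if_neg h, if_neg h2, add_zero]
  simp only [h1]
  rw [Finset.sum_add_distrib, Finset.sum_ite_eq' univ]
  simp

/-- the permutation of positions preserving residue classes -/
def permE (n k : ℕ) (hk : 0 < k) (h : ∀ j : Fin k, Equiv.Perm (Fin (cls n k j))) :
    Equiv.Perm (Fin n) :=
  (posE n k hk).symm.trans ((Equiv.sigmaCongrRight h).trans (posE n k hk))

lemma permE_posE (n k : ℕ) (hk : 0 < k) (h : ∀ j : Fin k, Equiv.Perm (Fin (cls n k j)))
    (j : Fin k) (q : Fin (cls n k j)) :
    permE n k hk h (posE n k hk ⟨j, q⟩) = posE n k hk ⟨j, h j q⟩ := by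
  simp [permE]

section
variable {R : Type*} [CommRing R] (t x : R)

/-- the signed width-`k` type B polynomial -/
def St (n k : ℕ) : R :=
  ∑ σ : Equiv.Perm (Fin n), ∑ ε : Fin n → Bool, tw t ε * x ^ desB n k (bval n σ ε)

lemma St_shift (n k : ℕ) (hk : 0 < k) (h : ∀ j : Fin k, Equiv.Perm (Fin (cls n k j))) :
    St t x n k = ∑ σ : Equiv.Perm (Fin n), ∑ ε : Fin n → Bool, tw t ε *
      x ^ ∑ j : Fin k, dj k j (cls n k j) (fun q => wd n σ ε (posE n k hk ⟨j, h j q⟩)) := by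
  unfold St
  symm
  refine Fintype.sum_equiv (Equiv.mulRight (permE n k hk h)) _ _ (fun σ => ?_)
  refine Fintype.sum_equiv (Equiv.arrowCongr (permE n k hk h).symm (Equiv.refl Bool)) _ _
    (fun ε => ?_)
  have e1 : tw t ((Equiv.arrowCongr (permE n k hk h).symm (Equiv.refl Bool)) ε) = tw t ε :=
    tw_comp t (permE n k hk h) ε
  rw [e1, desB_class n k hk]
  congr 2
  apply Finset.sum_congr rfl
  intro j _
  congr 1
  funext q
  simp [wd, permE_posE]

/-- sign vectors sorted by residue class -/
def sgnE (n k : ℕ) (hk : 0 < k) : (∀ j : Fin k, Fin (cls n k j) → Bool) ≃ (Fin n → Bool) :=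
  (Equiv.piCurry (fun (j : Fin k) (_ : Fin (cls n k j)) => Bool)).symm.trans
    (Equiv.arrowCongr (posE n k hk) (Equiv.refl Bool))

lemma sgnE_posE (n k : ℕ) (hk : 0 < k) (δ : ∀ j : Fin k, Fin (cls n k j) → Bool)
    (j : Fin k) (q : Fin (cls n k j)) : sgnE n k hk δ (posE n k hk ⟨j, q⟩) = δ j q := by
  change (fun p : (Σ j : Fin k, Fin (cls n k j)) => δ p.1 p.2)
    ((posE n k hk).symm (posE n k hk ⟨j, q⟩)) = δ j q
  rw [Equiv.symm_apply_apply]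

lemma tw_sgnE (n k : ℕ) (hk : 0 < k) (δ : ∀ j : Fin k, Fin (cls n k j) → Bool) :
    tw t (sgnE n k hk δ) = ∏ j, tw t (δ j) := by
  rw [← tw_comp t (posE n k hk)]
  unfold tw
  rw [Fintype.prod_sigma]
  simp only [sgnE_posE]

lemma prod_sum2 {ι : Type*} [Fintype ι] [DecidableEq ι] {α β : ι → Type*} [∀ i, Fintype (α i)]
    [∀ i, Fintype (β i)] (f : ∀ i, α i → β i → R) :
    ∑ a : ∀ i, α i, ∑ b : ∀ i, β i, ∏ i, f i (a i) (b i) = ∏ i, ∑ a, ∑ b, f i a b := by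
  rw [Finset.prod_univ_sum, Fintype.piFinset_univ]
  apply Finset.sum_congr rfl
  intro a _
  rw [Finset.prod_univ_sum, Fintype.piFinset_univ]

/-- factor of the residue class `j` -/
def fac (k j m : ℕ) : R := if j + 1 = k then EulBt t x m else (1 + t) ^ m * EulA m x

/-- contribution of one residue class -/
def psi (k j m : ℕ) (a : Fin m → ℤ) (d : Fin m → Bool) (g : Equiv.Perm (Fin m)) : R :=
  tw t d * x ^ dj k j m (fun q => sgB (d (g q)) * a (g q))

lemma sum_psi (k j : ℕ) {m : ℕ} (a : Fin m → ℤ) (ha : Function.Injective a)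
    (hp : ∀ q, 0 < a q) :
    ∑ d : Fin m → Bool, ∑ g : Equiv.Perm (Fin m), psi t x k j m a d g = fac t x k j m := by
  unfold fac psi dj
  by_cases h : j + 1 = k
  · simp only [if_pos h]
    exact lemB t x a ha hp
  · simp only [if_neg h]
    exact lemA t x a ha hp

lemma St_main (n k : ℕ) (hk : 0 < k) :
    ((∏ j : Fin k, (cls n k j).factorial : ℕ) : R) * St t x n k =
      (n.factorial : R) * ∏ j : Fin k, fac t x k j (cls n k j) := by
  have h1 : ((∏ j : Fin k, (cls n k j).factorial : ℕ) : R) * St t x n k =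
      ∑ _h : (∀ j : Fin k, Equiv.Perm (Fin (cls n k j))), St t x n k := by
    rw [Finset.sum_const, Finset.card_univ, Fintype.card_pi, nsmul_eq_mul]
    simp [Fintype.card_perm]
  rw [h1]
  rw [Finset.sum_congr rfl (fun h _ => St_shift t x n k hk h), Finset.sum_comm]
  have h2 : (n.factorial : R) * ∏ j : Fin k, fac t x k j (cls n k j) =
      ∑ _σ : Equiv.Perm (Fin n), ∏ j : Fin k, fac t x k j (cls n k j) := by
    rw [Finset.sum_const, Finset.card_univ, nsmul_eq_mul, Fintype.card_perm, Fintype.card_fin]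
  rw [h2]
  apply Finset.sum_congr rfl
  intro σ _
  rw [Finset.sum_comm, ← Equiv.sum_comp (sgnE n k hk)]
  have h3 : ∀ (δ : ∀ j : Fin k, Fin (cls n k j) → Bool)
      (h : ∀ j : Fin k, Equiv.Perm (Fin (cls n k j))),
      tw t (sgnE n k hk δ) * x ^ ∑ j : Fin k, dj k j (cls n k j)
        (fun q => wd n σ (sgnE n k hk δ) (posE n k hk ⟨j, h j q⟩)) =
      ∏ j : Fin k, psi t x k j (cls n k j)
        (fun q => ((σ (posE n k hk ⟨j, q⟩) : ℕ) : ℤ) + 1) (δ j) (h j) := by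
    intro δ h
    unfold psi
    rw [tw_sgnE, Finset.prod_mul_distrib, Finset.prod_pow_eq_pow_sum]
    simp only [wd, sgnE_posE]
  rw [Finset.sum_congr rfl fun δ _ => Finset.sum_congr rfl fun h _ => h3 δ h]
  rw [prod_sum2 (α := fun j : Fin k => Fin (cls n k j) → Bool)
    (β := fun j : Fin k => Equiv.Perm (Fin (cls n k j)))
    (fun j d g => psi t x k j (cls n k j)
        (fun q => ((σ (posE n k hk ⟨j, q⟩) : ℕ) : ℤ) + 1) d g)]
  apply Finset.prod_congr rfl
  intro j _
  have ha : Function.Injective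
      (fun q : Fin (cls n k j) => (((σ (posE n k hk ⟨j, q⟩) : ℕ) : ℤ) + 1)) := by
    intro p q h
    have h' : (σ (posE n k hk ⟨j, p⟩)) = (σ (posE n k hk ⟨j, q⟩)) := by
      apply Fin.ext
      simp only at h
      omega
    have := (posE n k hk).injective (σ.injective h')
    simpa using this
  have hp : ∀ q : Fin (cls n k j), 0 < (((σ (posE n k hk ⟨j, q⟩) : ℕ) : ℤ) + 1) := by
    intro q; omega
  exact sum_psi t x k j _ ha hp

lemma prod_cls (n k : ℕ) (hk : 0 < k) {M : Type*} [CommMonoid M] (f : ℕ → ℕ → M) (a b c : M)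
    (ha : ∀ j, j < n % k → f j (cls n k j) = a)
    (hb : ∀ j, n % k ≤ j → j + 1 < k → f j (cls n k j) = b)
    (hc : f (k - 1) (cls n k (k - 1)) = c) :
    ∏ j : Fin k, f j (cls n k j) = a ^ (n % k) * b ^ (k - n % k - 1) * c := by
  have hr := Nat.mod_lt n hk
  rw [Fin.prod_univ_eq_prod_range (fun j => f j (cls n k j)) k]
  have e : k = n % k + (k - n % k - 1) + 1 := by omega
  have e' : n % k + (k - n % k - 1) = k - 1 := by omega
  rw [show range k = range (n % k + (k - n % k - 1) + 1) from congrArg range e]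
  rw [Finset.prod_range_succ, Finset.prod_range_add, e', hc]
  congr 2
  · rw [Finset.prod_congr rfl (fun j hj => ha j (mem_range.1 hj))]; simp
  · rw [Finset.prod_congr rfl (fun j hj => hb (n % k + j) (by omega)
      (by have := mem_range.1 hj; omega))]; simp

lemma cls_lt {n k j : ℕ} (h : j < n % k) : cls n k j = n / k + 1 := by simp [cls, h]

lemma cls_ge {n k j : ℕ} (h : n % k ≤ j) : cls n k j = n / k := by
  simp [cls, Nat.not_lt.2 h]

lemma prod_fact (n k : ℕ) (hk : 0 < k) : ∏ j : Fin k, (cls n k j).factorial =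
    (n / k + 1).factorial ^ (n % k) * (n / k).factorial ^ (k - n % k) := by
  have hr := Nat.mod_lt n hk
  rw [prod_cls n k hk (fun _ m => m.factorial) (n / k + 1).factorial (n / k).factorial
    (n / k).factorial (fun j h => by simp only [cls_lt h]) (fun j h _ => by simp only [cls_ge h])
    (by simp only [cls_ge (show n % k ≤ k - 1 by omega)])]
  rw [mul_assoc, ← pow_succ, show k - n % k - 1 + 1 = k - n % k by omega]

lemma sum_cls (n k : ℕ) (hk : 0 < k) : ∑ j : Fin k, cls n k j = n := by
  have := Fintype.card_congr (posE n k hk)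
  simpa [Fintype.card_sigma] using this

lemma Mnk_mul (n k : ℕ) (hk : 0 < k) :
    (∏ j : Fin k, (cls n k j).factorial) * Mnk n k = n.factorial := by
  have hd := Nat.prod_factorial_dvd_factorial_sum (univ : Finset (Fin k)) (fun j => cls n k j)
  rw [sum_cls n k hk] at hd
  unfold Mnk
  rw [← prod_fact n k hk]
  exact Nat.mul_div_cancel' hd

lemma prod_fac (n k : ℕ) (hk : 0 < k) : ∏ j : Fin k, fac t x k j (cls n k j) =
    (1 + t) ^ (n - n / k) * EulBt t x (n / k) * EulA (n / k) x ^ (k - n % k - 1) *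
      EulA (n / k + 1) x ^ (n % k) := by
  have hr := Nat.mod_lt n hk
  rw [prod_cls n k hk (fac t x k) ((1 + t) ^ (n / k + 1) * EulA (n / k + 1) x)
    ((1 + t) ^ (n / k) * EulA (n / k) x) (EulBt t x (n / k))
    (fun j h => by rw [cls_lt h, fac, if_neg (by omega)])
    (fun j h h' => by rw [cls_ge h, fac, if_neg (by omega)])
    (by rw [cls_ge (show n % k ≤ k - 1 by omega), fac, if_pos (by omega)])]
  have e : n - n / k = (n / k + 1) * (n % k) + n / k * (k - n % k - 1) := by
    have h := Nat.div_add_mod n k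
    obtain ⟨s, hs⟩ : ∃ s, k = n % k + s + 1 := ⟨k - n % k - 1, by omega⟩
    have e2 : k - n % k - 1 = s := by omega
    rw [e2]
    have : n = (n / k + 1) * (n % k) + n / k * s + n / k := by
      calc n = k * (n / k) + n % k := h.symm
        _ = (n % k + s + 1) * (n / k) + n % k := by rw [← hs]
        _ = _ := by ring
    omega
  rw [e, mul_pow, mul_pow, ← pow_mul, ← pow_mul, pow_add]
  ring

end

lemma tw_neg_one {R : Type*} [CommRing R] {n : ℕ} (ε : Fin n → Bool) :
    tw (-1 : R) ε = if Even (Finset.univ.filter fun i => ε i = true).card then 1 else -1 := by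
  unfold tw
  rw [Finset.prod_ite]
  simp only [prod_const, one_pow, mul_one]
  split_ifs with h
  · exact h.neg_one_pow
  · exact (Nat.not_even_iff_odd.1 h).neg_one_pow

lemma tw_one {R : Type*} [CommRing R] {n : ℕ} (ε : Fin n → Bool) : tw (1 : R) ε = 1 := by
  simp [tw]

/-- the width-`k` type D polynomial -/
def SD {R : Type*} [CommRing R] (n k : ℕ) (x : R) : R :=
  ∑ σ : Equiv.Perm (Fin n),
    ∑ ε ∈ Finset.univ.filter
        (fun ε : Fin n → Bool => Even (Finset.univ.filter fun i => ε i = true).card),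
      x ^ desB n k (bval n σ ε)

lemma two_SD {R : Type*} [CommRing R] (n k : ℕ) (x : R) :
    2 * SD n k x = St 1 x n k + St (-1) x n k := by
  unfold SD St
  rw [← Finset.sum_add_distrib, Finset.mul_sum]
  apply Finset.sum_congr rfl
  intro σ _
  rw [← Finset.sum_add_distrib, Finset.mul_sum, Finset.sum_filter]
  apply Finset.sum_congr rfl
  intro ε _
  rw [tw_one, tw_neg_one]
  split_ifs <;> ring

lemma St_poly (n k : ℕ) (hk : 0 < k) (t : Polynomial ℤ) :
    St t Polynomial.X n k = (Mnk n k : Polynomial ℤ) *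
      ((1 + t) ^ (n - n / k) * EulBt t Polynomial.X (n / k) *
        EulA (n / k) Polynomial.X ^ (k - n % k - 1) *
      EulA (n / k + 1) Polynomial.X ^ (n % k)) := by
  have h := St_main t (Polynomial.X) n k hk
  rw [← Mnk_mul n k hk, prod_fac t _ n k hk, Nat.cast_mul, mul_assoc] at h
  refine mul_left_cancel₀ ?_ h
  rw [Nat.cast_ne_zero]
  exact Finset.prod_ne_zero_iff.2 (fun j _ => Nat.factorial_ne_zero _)

lemma EulBt_one {R : Type*} [CommRing R] (m : ℕ) (x : R) : EulBt 1 x m = EulB m x := by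
  simp only [EulBt, EulB, tw_one, one_mul, desB_one]

lemma St_one {R : Type*} [CommRing R] (n k : ℕ) (x : R) : St 1 x n k =
    ∑ σ : Equiv.Perm (Fin n), ∑ ε : Fin n → Bool, x ^ desB n k (bval n σ ε) := by
  simp only [St, tw_one, one_mul]

lemma div_lt_n (n k : ℕ) (hk : 2 ≤ k) (hkn : k ≤ n) : n / k < n :=
  Nat.div_lt_self (by omega) (by omega)

lemma SD_poly (n k : ℕ) (hk : 2 ≤ k) (hkn : k ≤ n) :
    2 * SD n k (Polynomial.X : Polynomial ℤ) = St 1 Polynomial.X n k ∧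
    SD n k (Polynomial.X : Polynomial ℤ) =
      2 ^ (n - n / k - 1) * (Mnk n k : Polynomial ℤ) * EulB (n / k) Polynomial.X *
        (EulA (n / k) Polynomial.X) ^ (k - n % k - 1) *
        (EulA (n / k + 1) Polynomial.X) ^ (n % k) := by
  have hlt := div_lt_n n k hk hkn
  have h2 := two_SD n k (Polynomial.X : Polynomial ℤ)
  have h0 : St (-1) (Polynomial.X : Polynomial ℤ) n k = 0 := by
    rw [St_poly n k (by omega), add_neg_cancel, zero_pow (by omega)]
    ring
  rw [h0, add_zero] at h2
  refine ⟨h2, ?_⟩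
  rw [St_poly n k (by omega), EulBt_one] at h2
  refine mul_left_cancel₀ (two_ne_zero) (h2.trans ?_)
  have e : n - n / k = (n - n / k - 1) + 1 := by omega
  rw [one_add_one_eq_two]
  conv_lhs => rw [e]
  rw [pow_succ]
  ring

/-- Theorem 24: for `2 ≤ k ≤ n`, the width-`k` type-D Eulerian
polynomial (sum over signed permutations with an even number of negative entries)
equals `2^{n-d-1} M_{n,k} B_d(x) A_d(x)^{k-r-1} A_{d+1}(x)^r`; in particular it is
half the width-`k` type-B Eulerian polynomial. -/
theorem stmt16 (n k : ℕ) (hk : 2 ≤ k) (hkn : k ≤ n) (R : Type*) [CommRing R] (x : R) :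
    (∑ σ : Equiv.Perm (Fin n),
        ∑ ε ∈ Finset.univ.filter
            (fun ε : Fin n → Bool => Even (Finset.univ.filter fun i => ε i = true).card),
          x ^ desB n k (bval n σ ε)) =
      2 ^ (n - n / k - 1) * (Mnk n k : R) * EulB (n / k) x *
        (EulA (n / k) x) ^ (k - n % k - 1) * (EulA (n / k + 1) x) ^ (n % k) ∧
    2 * (∑ σ : Equiv.Perm (Fin n),
        ∑ ε ∈ Finset.univ.filter
            (fun ε : Fin n → Bool => Even (Finset.univ.filter fun i => ε i = true).card),
          x ^ desB n k (bval n σ ε)) =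
      ∑ σ : Equiv.Perm (Fin n), ∑ ε : Fin n → Bool, x ^ desB n k (bval n σ ε) := by
  obtain ⟨h1, h2⟩ := SD_poly n k hk hkn
  have k1 := congrArg (Polynomial.eval₂RingHom (Int.castRingHom R) x) h1
  have k2 := congrArg (Polynomial.eval₂RingHom (Int.castRingHom R) x) h2
  rw [St_one] at k1
  simp only [SD, EulB, EulA, map_mul, map_sum, map_pow, map_natCast, map_ofNat,
    Polynomial.coe_eval₂RingHom, Polynomial.eval₂_X] at k1 k2
  exact ⟨k2, k1⟩
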